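/- arXiv:2506.10775 — 6 statements merged into one kernel-verified Lean document; each statement's English description precedes it below -/
import Mathlib

section
/- Let P be a finite multiset of labeled points in ℝ^d and h a monotone classifier. Then the sum of |I_good(q)| over all h-good elements q ∈ P equals the sum of |I_bad(p)| over all h-bad elements p ∈ P. -/
open scoped Classical

noncomputable section

/-- `p` dominates `q`: `p ≠ q` and `p[i] ≥ q[i]` for every coordinate `i`. -/
def dominates {d : ℕ} (p q : Fin d → ℝ) : Prop := p ≠ q ∧ ∀ i, q i ≤ p i

/-- `p ⪰ q`: `p = q` or `p` dominates `q`. -/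
def domEq {d : ℕ} (p q : Fin d → ℝ) : Prop := p = q ∨ dominates p q

/-- The influence set `I_bad(p)` of an `h`-bad element `p` of `P`. -/
def Ibad {d : ℕ} (P : Multiset ((Fin d → ℝ) × ℤ)) (h : (Fin d → ℝ) → ℤ)
    (p : (Fin d → ℝ) × ℤ) : Multiset ((Fin d → ℝ) × ℤ) :=
  if p.2 = -1 then
    P.filter (fun q => h q.1 = q.2 ∧ domEq p.1 q.1 ∧ q.2 = 1)
  else
    P.filter (fun q => h q.1 = q.2 ∧ domEq q.1 p.1 ∧ q.2 = -1)

/-- The influence set `I_good(q)` of an `h`-good element `q` of `P`. -/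
def Igood {d : ℕ} (P : Multiset ((Fin d → ℝ) × ℤ)) (h : (Fin d → ℝ) → ℤ)
    (q : (Fin d → ℝ) × ℤ) : Multiset ((Fin d → ℝ) × ℤ) :=
  if q.2 = -1 then
    P.filter (fun p => h p.1 ≠ p.2 ∧ domEq q.1 p.1)
  else
    P.filter (fun p => h p.1 ≠ p.2 ∧ domEq p.1 q.1)

theorem Multiset.sum_card_filter_comm {α β : Type*} (s : Multiset α) (t : Multiset β)
    (r : α → β → Prop) :
    (s.map fun a => Multiset.card (t.filter fun b => r a b)).sum
      = (t.map fun b => Multiset.card (s.filter fun a => r a b)).sum := by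
  simp only [← Multiset.countP_eq_card_filter]
  induction s using Multiset.induction_on with
  | empty => simp
  | cons a s ih =>
    simp only [Multiset.map_cons, Multiset.sum_cons, ih, Multiset.countP_cons,
      Multiset.sum_map_add]
    rw [add_comm]
    congr 1
    clear ih
    induction t using Multiset.induction_on with
    | empty => simp
    | cons b t iht => simp_all [Multiset.countP_cons, add_comm]

theorem le_of_domEq {d : ℕ} {h : (Fin d → ℝ) → ℤ}
    (hmono : ∀ p q : Fin d → ℝ, dominates p q → h q ≤ h p) {p q : Fin d → ℝ}
    (hpq : domEq p q) : h q ≤ h p := by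
  rcases hpq with rfl | hpq
  · exact le_rfl
  · exact hmono _ _ hpq

/-- The sum of `|I_good(q)|` over all `h`-good `q ∈ P` equals the sum of
`|I_bad(p)|` over all `h`-bad `p ∈ P`. -/
theorem stmt1 {d : ℕ} (P : Multiset ((Fin d → ℝ) × ℤ)) (h : (Fin d → ℝ) → ℤ)
    (hcod : ∀ x : Fin d → ℝ, h x = 1 ∨ h x = -1)
    (hmono : ∀ p q : Fin d → ℝ, dominates p q → h q ≤ h p)
    (hlab : ∀ x ∈ P, x.2 = 1 ∨ x.2 = (-1 : ℤ)) :
    ((P.filter (fun q => h q.1 = q.2)).map (fun q => Multiset.card (Igood P h q))).sum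
      = ((P.filter (fun p => h p.1 ≠ p.2)).map (fun p => Multiset.card (Ibad P h p))).sum := by
  set good := P.filter (fun q => h q.1 = q.2)
  set bad := P.filter (fun p => h p.1 ≠ p.2)
  let r : (Fin d → ℝ) × ℤ → (Fin d → ℝ) × ℤ → Prop := fun q p =>
    if q.2 = -1 then domEq q.1 p.1 else domEq p.1 q.1
  have hgood : ∀ q ∈ good, Multiset.card (Igood P h q)
      = Multiset.card (bad.filter fun p => r q p) := by
    intro q _
    by_cases hq : q.2 = -1 <;>
      simp only [Igood, hq, if_true, if_false, bad, r, Multiset.filter_filter, and_comm]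
  have hbad : ∀ p ∈ bad, Multiset.card (Ibad P h p)
      = Multiset.card (good.filter fun q => r q p) := by
    intro p hp
    obtain ⟨hpP, hph⟩ := Multiset.mem_filter.1 hp
    simp only [Ibad, good, r, Multiset.filter_filter]
    split_ifs with hp2 <;>
    · congr 1
      refine Multiset.filter_congr fun q hq => ?_
      have hpq := fun H : domEq p.1 q.1 => le_of_domEq hmono H
      have hqp := fun H : domEq q.1 p.1 => le_of_domEq hmono H
      have hp' := hcod p.1
      have hq' := hlab q hq
      have hp'' := hlab p hpP
      grind
  rw [Multiset.map_congr rfl hgood, Multiset.map_congr rfl hbad]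
  convert Multiset.sum_card_filter_comm good bad r
end
end

section
/- Let P be a finite multiset of labeled points in ℝ^d, h a monotone classifier, and z ∈ P. Define P_z = P minus all elements p with p ⪰ z if label(z) = 1, and P_z = P minus all elements p with z ⪰ p if label(z) = −1. If z is h-bad then err_{P_z}(h) ≤ err_P(h) − 1; if z is h-good then err_{P_z}(h) ≤ err_P(h) − |I_good(z)|. -/
open scoped Classical

noncomputable section

/-- The error of classifier `h` on a labeled multiset `Q`. -/
def errP {d : ℕ} (Q : Multiset ((Fin d → ℝ) × ℤ)) (h : (Fin d → ℝ) → ℤ) : ℕ :=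
  Multiset.card (Q.filter (fun x => h x.1 ≠ x.2))

/-- `P_z`: remove from `P` every element `p ⪰ z` if `label(z) = 1`,
and every element `p ⪯ z` if `label(z) = −1`. -/
def Pz {d : ℕ} (P : Multiset ((Fin d → ℝ) × ℤ)) (z : (Fin d → ℝ) × ℤ) :
    Multiset ((Fin d → ℝ) × ℤ) :=
  if z.2 = 1 then P.filter (fun p => ¬ domEq p.1 z.1)
  else P.filter (fun p => ¬ domEq z.1 p.1)

theorem card_filter_filter_not_add {α : Type*} (s : Multiset α) (p q : α → Prop) :
    Multiset.card ((s.filter (fun x => ¬ q x)).filter p) +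
      Multiset.card (s.filter (fun x => p x ∧ q x)) = Multiset.card (s.filter p) := by
  rw [← Multiset.filter_add_not q (s.filter p), Multiset.card_add, Multiset.filter_filter,
    Multiset.filter_filter, Multiset.filter_filter, add_comm]
  simp only [and_comm]

theorem domEq_refl {d : ℕ} (p : Fin d → ℝ) : domEq p p := Or.inl rfl

theorem errP_Pz_add_card_Igood {d : ℕ} (P : Multiset ((Fin d → ℝ) × ℤ))
    (h : (Fin d → ℝ) → ℤ) (z : (Fin d → ℝ) × ℤ) (hz : z.2 = 1 ∨ z.2 = -1) :
    errP (Pz P z) h + Multiset.card (Igood P h z) = errP P h := by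
  unfold errP Pz Igood
  rcases hz with hz | hz
  · simpa [hz] using card_filter_filter_not_add P (fun x => h x.1 ≠ x.2) (fun x => domEq x.1 z.1)
  · simpa [hz] using card_filter_filter_not_add P (fun x => h x.1 ≠ x.2) (fun x => domEq z.1 x.1)

theorem mem_Igood_self {d : ℕ} {P : Multiset ((Fin d → ℝ) × ℤ)} {h : (Fin d → ℝ) → ℤ}
    {z : (Fin d → ℝ) × ℤ} (hz : z ∈ P) (hbad : h z.1 ≠ z.2) : z ∈ Igood P h z := by
  unfold Igood
  split_ifs <;> exact Multiset.mem_filter.2 ⟨hz, hbad, domEq_refl _⟩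

/-- If `z` is `h`-bad then `err_{P_z}(h) ≤ err_P(h) − 1`;
if `z` is `h`-good then `err_{P_z}(h) ≤ err_P(h) − |I_good(z)|`. -/
theorem stmt2 {d : ℕ} (P : Multiset ((Fin d → ℝ) × ℤ)) (h : (Fin d → ℝ) → ℤ)
    (hcod : ∀ x : Fin d → ℝ, h x = 1 ∨ h x = -1)
    (hmono : ∀ p q : Fin d → ℝ, dominates p q → h q ≤ h p)
    (hlab : ∀ x ∈ P, x.2 = 1 ∨ x.2 = (-1 : ℤ))
    (z : (Fin d → ℝ) × ℤ) (hz : z ∈ P) :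
    (h z.1 ≠ z.2 → (errP (Pz P z) h : ℤ) ≤ (errP P h : ℤ) - 1) ∧
    (h z.1 = z.2 →
      (errP (Pz P z) h : ℤ) ≤ (errP P h : ℤ) - Multiset.card (Igood P h z)) := by
  have key := errP_Pz_add_card_Igood P h z (hlab z hz)
  refine ⟨fun hbad => ?_, fun _ => ?_⟩
  · have hpos := Multiset.card_pos_iff_exists_mem.2 ⟨z, mem_Igood_self hz hbad⟩
    omega
  · omega
end
end

section
/- Let P be a finite multiset of labeled points in ℝ^d and h any monotone classifier. When the RPE algorithm is run on P, the expected number of h-good elements of P that are misclassified by the resulting classifier h_RPE is at most err_P(h). -/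
open scoped Classical ENNReal

noncomputable section

/-- The RPE algorithm with step budget `fuel`: while `P` is nonempty, probe a
uniformly random `z ∈ P`, add it to the output, and eliminate as in `Pz`.
Since each iteration removes at least the probed element, running it with
`fuel = |P|` realizes the RPE algorithm exactly. The result is the
distribution over the output set `Z` of probed elements. -/
def rpeAux {d : ℕ} : ℕ → Multiset ((Fin d → ℝ) × ℤ) → PMF (Multiset ((Fin d → ℝ) × ℤ))
  | 0, _ => PMF.pure 0
  | (fuel + 1), P =>
    if hP : P = 0 then PMF.pure 0
    else (PMF.ofMultiset P hP).bind fun z =>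
      (rpeAux fuel (Pz P z)).map (fun Z => z ::ₘ Z)

/-- The distribution over the output set `Z` produced by running RPE on `P`. -/
def rpe {d : ℕ} (P : Multiset ((Fin d → ℝ) × ℤ)) : PMF (Multiset ((Fin d → ℝ) × ℤ)) :=
  rpeAux (Multiset.card P) P

/-- The classifier `h_RPE` determined by the probed set `Z`. -/
def hRPE {d : ℕ} (Z : Multiset ((Fin d → ℝ) × ℤ)) : (Fin d → ℝ) → ℤ :=
  fun p => if ∃ z ∈ Z, z.2 = 1 ∧ domEq p z.1 then 1 else -1

/-- `z` eliminates `p` when `z` is probed by RPE. -/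
def Eliminates {d : ℕ} (z p : (Fin d → ℝ) × ℤ) : Prop :=
  if z.2 = 1 then domEq p.1 z.1 else domEq z.1 p.1

theorem domEq_iff_le {d : ℕ} (p q : Fin d → ℝ) : domEq p q ↔ q ≤ p := by
  unfold domEq dominates
  constructor
  · rintro (rfl | ⟨-, hle⟩)
    · exact le_rfl
    · exact hle
  · intro hle
    by_cases hpq : p = q
    · exact Or.inl hpq
    · exact Or.inr ⟨hpq, hle⟩

theorem Pz_eq_filter {d : ℕ} (P : Multiset ((Fin d → ℝ) × ℤ)) (z : (Fin d → ℝ) × ℤ) :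
    Pz P z = P.filter (fun p => ¬ Eliminates z p) := by
  unfold Pz Eliminates
  split_ifs <;> rfl

theorem Eliminates.refl {d : ℕ} (z : (Fin d → ℝ) × ℤ) : Eliminates z z := by
  simp [Eliminates, domEq]

theorem Eliminates.symm_of_ne {d : ℕ} {z p : (Fin d → ℝ) × ℤ}
    (hz : z.2 = 1 ∨ z.2 = -1) (hp : p.2 = 1 ∨ p.2 = -1) (hne : p.2 ≠ z.2)
    (hzp : Eliminates z p) : Eliminates p z := by
  unfold Eliminates at *
  rcases hz with hz | hz <;> rcases hp with hp | hp <;> simp_all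

theorem Eliminates.ne_label_of_good {d : ℕ} {h : (Fin d → ℝ) → ℤ}
    (hmono : ∀ p q : Fin d → ℝ, dominates p q → h q ≤ h p) {z p : (Fin d → ℝ) × ℤ}
    (hz : z.2 = 1 ∨ z.2 = -1) (hp : p.2 = 1 ∨ p.2 = -1) (hne : p.2 ≠ z.2)
    (hgood : h p.1 = p.2) (hzp : Eliminates z p) : h z.1 ≠ z.2 := by
  have mono : ∀ a b, domEq a b → h b ≤ h a := by
    rintro a b (rfl | hab)
    · exact le_rfl
    · exact hmono a b hab
  unfold Eliminates at hzp
  split_ifs at hzp with h1 <;> have := mono _ _ hzp <;> omega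

theorem card_Pz_lt {d : ℕ} {P : Multiset ((Fin d → ℝ) × ℤ)} {z : (Fin d → ℝ) × ℤ}
    (hz : z ∈ P) : Multiset.card (Pz P z) < Multiset.card P := by
  rw [Pz_eq_filter]
  refine Multiset.card_lt_card (lt_of_le_of_ne (Multiset.filter_le _ _) fun heq => ?_)
  exact (Multiset.filter_eq_self.1 heq z hz) (Eliminates.refl z)

theorem PMF.tsum_bind_mul {α β : Type*} (p : PMF α) (f : α → PMF β) (F : β → ℝ≥0∞) :
    ∑' b, p.bind f b * F b = ∑' a, p a * ∑' b, f a b * F b := by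
  simp only [PMF.bind_apply, ← ENNReal.tsum_mul_right, ← ENNReal.tsum_mul_left]
  rw [ENNReal.tsum_comm]
  simp only [mul_assoc]

theorem PMF.tsum_pure_mul {α : Type*} (a : α) (F : α → ℝ≥0∞) :
    ∑' b, PMF.pure a b * F b = F a := by
  rw [tsum_eq_single a]
  · simp
  · intro b hb
    simp [PMF.pure_apply, hb]

theorem PMF.tsum_map_mul {α β : Type*} (p : PMF α) (g : α → β) (F : β → ℝ≥0∞) :
    ∑' b, p.map g b * F b = ∑' a, p a * F (g a) := by
  unfold PMF.map
  rw [PMF.tsum_bind_mul]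
  simp only [Function.comp_apply, PMF.tsum_pure_mul]

theorem PMF.tsum_ofMultiset_mul {α : Type*} (P : Multiset α) (hP : P ≠ 0) (G : α → ℝ≥0∞) :
    ∑' a, PMF.ofMultiset P hP a * G a = (P.map G).sum / Multiset.card P := by
  rw [Finset.sum_multiset_map_count, ENNReal.div_eq_inv_mul, Finset.mul_sum,
    tsum_eq_sum (s := P.toFinset)]
  · refine Finset.sum_congr rfl fun a _ => ?_
    rw [PMF.ofMultiset_apply, ENNReal.div_eq_inv_mul, nsmul_eq_mul, mul_assoc]
  · intro a ha
    rw [PMF.ofMultiset_apply_of_notMem hP (by simpa using ha), zero_mul]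

theorem subset_of_mem_support_rpeAux {d : ℕ} (n : ℕ) (P Z : Multiset ((Fin d → ℝ) × ℤ))
    (hZ : Z ∈ (rpeAux n P).support) : Z ⊆ P := by
  induction n generalizing P Z with
  | zero =>
    have : Z = 0 := by simpa [rpeAux] using hZ
    simp [this]
  | succ n ih =>
    rw [rpeAux] at hZ
    split_ifs at hZ with hP
    · have : Z = 0 := by simpa using hZ
      simp [this]
    · rw [PMF.mem_support_bind_iff] at hZ
      obtain ⟨z, hz, hZ⟩ := hZ
      rw [PMF.mem_support_map_iff] at hZ
      obtain ⟨Z', hZ', rfl⟩ := hZ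
      refine Multiset.cons_subset.2 ⟨by simpa using hz, fun x hx => ?_⟩
      have hxPz := ih _ _ hZ' hx
      rw [Pz_eq_filter] at hxPz
      exact Multiset.mem_of_mem_filter hxPz

/-- The elements of `P` that are `h`-good and misclassified by `h_RPE`. -/
def misclassifiedGood {d : ℕ} (P : Multiset ((Fin d → ℝ) × ℤ)) (h : (Fin d → ℝ) → ℤ)
    (Z : Multiset ((Fin d → ℝ) × ℤ)) : ℕ :=
  Multiset.card (P.filter (fun p => h p.1 = p.2 ∧ hRPE Z p.1 ≠ p.2))

/-- The number of `h`-good elements of `P` eliminated by a probe of the opposite label. -/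
def wronglyEliminated {d : ℕ} (P : Multiset ((Fin d → ℝ) × ℤ)) (h : (Fin d → ℝ) → ℤ)
    (z : (Fin d → ℝ) × ℤ) : ℕ :=
  Multiset.card (P.filter (fun p => h p.1 = p.2 ∧ p.2 ≠ z.2 ∧ Eliminates z p))

/-- The number of `h`-bad elements of `P` eliminated by a probe. -/
def badEliminated {d : ℕ} (P : Multiset ((Fin d → ℝ) × ℤ)) (h : (Fin d → ℝ) → ℤ)
    (z : (Fin d → ℝ) × ℤ) : ℕ :=
  Multiset.card (P.filter (fun p => h p.1 ≠ p.2 ∧ Eliminates z p))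

theorem errP_Pz_add_badEliminated {d : ℕ} (P : Multiset ((Fin d → ℝ) × ℤ))
    (h : (Fin d → ℝ) → ℤ) (z : (Fin d → ℝ) × ℤ) :
    badEliminated P h z + errP (Pz P z) h = errP P h := by
  unfold badEliminated errP
  rw [Pz_eq_filter, Multiset.filter_filter, ← Multiset.card_add]
  conv_rhs => rw [← Multiset.filter_add_not (fun p => Eliminates z p)
    (P.filter (fun x => h x.1 ≠ x.2))]
  rw [Multiset.filter_filter, Multiset.filter_filter]
  simp only [and_comm]

theorem Multiset.card_filter_eq_sum_map {α : Type*} (P : Multiset α) (q : α → Prop)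
    [DecidablePred q] :
    Multiset.card (P.filter q) = (P.map fun a => if q a then 1 else 0).sum := by
  rw [← Multiset.countP_eq_card_filter]
  induction P using Multiset.induction_on with
  | empty => simp
  | cons a s ih => simp [Multiset.countP_cons, ih, add_comm]

theorem sum_wronglyEliminated_le {d : ℕ} (P : Multiset ((Fin d → ℝ) × ℤ))
    (h : (Fin d → ℝ) → ℤ) (hlab : ∀ x ∈ P, x.2 = 1 ∨ x.2 = (-1 : ℤ))
    (hmono : ∀ p q : Fin d → ℝ, dominates p q → h q ≤ h p) :
    (P.map (wronglyEliminated P h)).sum ≤ (P.map (badEliminated P h)).sum := by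
  unfold wronglyEliminated badEliminated
  simp only [Multiset.card_filter_eq_sum_map]
  rw [Multiset.sum_map_sum_map]
  refine Multiset.sum_map_le_sum_map _ _ fun p hp => Multiset.sum_map_le_sum_map _ _ fun z hz => ?_
  by_cases hc : h p.1 = p.2 ∧ p.2 ≠ z.2 ∧ Eliminates z p
  · obtain ⟨hgood, hne, hzp⟩ := hc
    have h1 := Eliminates.ne_label_of_good hmono (hlab z hz) (hlab p hp) hne hgood hzp
    have h2 := Eliminates.symm_of_ne (hlab z hz) (hlab p hp) hne hzp
    simp [h1, h2, hgood, hne, hzp]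
  · rw [if_neg hc]
    exact Nat.zero_le _

theorem misclassifiedGood_cons_le {d : ℕ} {P Z : Multiset ((Fin d → ℝ) × ℤ)}
    (h : (Fin d → ℝ) → ℤ) {z : (Fin d → ℝ) × ℤ}
    (hlab : ∀ x ∈ P, x.2 = 1 ∨ x.2 = (-1 : ℤ)) (hz : z ∈ P) (hZ : Z ⊆ Pz P z) :
    misclassifiedGood P h (z ::ₘ Z) ≤ wronglyEliminated P h z + misclassifiedGood (Pz P z) h Z := by
  unfold misclassifiedGood wronglyEliminated
  rw [Pz_eq_filter] at *
  rw [Multiset.filter_filter]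
  simp only [Multiset.card_filter_eq_sum_map]
  rw [← Multiset.sum_map_add]
  refine Multiset.sum_map_le_sum_map _ _ fun p hp => ?_
  by_cases hc : h p.1 = p.2 ∧ hRPE (z ::ₘ Z) p.1 ≠ p.2
  · rw [if_pos hc]
    obtain ⟨hgood, hmis⟩ := hc
    by_cases hel : Eliminates z p
    · have hne : p.2 ≠ z.2 := by
        intro heq
        apply hmis
        unfold Eliminates at hel
        unfold hRPE
        rcases hlab z hz with hz1 | hz1
        · rw [if_pos hz1] at hel
          rw [if_pos ⟨z, Multiset.mem_cons_self z Z, hz1, hel⟩, heq, hz1]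
        · rw [if_neg (by omega)] at hel
          rw [if_neg, heq, hz1]
          rintro ⟨w, hw, hw1, hpw⟩
          rcases Multiset.mem_cons.1 hw with rfl | hw
          · omega
          · refine (Multiset.mem_filter.1 (hZ hw)).2 ?_
            unfold Eliminates
            rw [if_neg (by omega)]
            rw [domEq_iff_le] at *
            exact hpw.trans hel
      simp [hgood, hne, hel]
    · have hcl : hRPE (z ::ₘ Z) p.1 = hRPE Z p.1 := by
        unfold hRPE
        unfold Eliminates at hel
        congr 1
        refine propext ⟨?_, fun ⟨w, hw, hw'⟩ => ⟨w, Multiset.mem_cons_of_mem hw, hw'⟩⟩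
        rintro ⟨w, hw, hw1, hpw⟩
        rcases Multiset.mem_cons.1 hw with rfl | hw
        · rw [if_pos hw1] at hel
          exact absurd hpw hel
        · exact ⟨w, hw, hw1, hpw⟩
      rw [hcl] at hmis
      simp [hgood, hmis, hel]
  · rw [if_neg hc]
    exact Nat.zero_le _

theorem tsum_rpeAux_mul_misclassifiedGood_le {d : ℕ} (h : (Fin d → ℝ) → ℤ)
    (hmono : ∀ p q : Fin d → ℝ, dominates p q → h q ≤ h p) (n : ℕ)
    (P : Multiset ((Fin d → ℝ) × ℤ)) (hn : Multiset.card P ≤ n)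
    (hlab : ∀ x ∈ P, x.2 = 1 ∨ x.2 = (-1 : ℤ)) :
    ∑' Z, rpeAux n P Z * (misclassifiedGood P h Z : ℝ≥0∞) ≤ errP P h := by
  induction n generalizing P with
  | zero =>
    obtain rfl : P = 0 := by simpa using hn
    simp [misclassifiedGood]
  | succ n ih =>
    by_cases hP : P = 0
    · simp [hP, misclassifiedGood]
    have hcard : (Multiset.card P : ℝ≥0∞) ≠ 0 := by simpa using hP
    rw [rpeAux, dif_neg hP, PMF.tsum_bind_mul, PMF.tsum_ofMultiset_mul]
    simp only [PMF.tsum_map_mul]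
    refine ENNReal.div_le_of_le_mul ?_
    have step : ∀ z ∈ P, ∑' Z, rpeAux n (Pz P z) Z * (misclassifiedGood P h (z ::ₘ Z) : ℝ≥0∞)
        ≤ ((wronglyEliminated P h z + errP (Pz P z) h : ℕ) : ℝ≥0∞) := by
      intro z hz
      have hsub : ∀ x ∈ Pz P z, x ∈ P := by
        rw [Pz_eq_filter]
        exact fun x hx => Multiset.mem_of_mem_filter hx
      calc ∑' Z, rpeAux n (Pz P z) Z * (misclassifiedGood P h (z ::ₘ Z) : ℝ≥0∞)
          ≤ ∑' Z, (rpeAux n (Pz P z) Z * (wronglyEliminated P h z : ℝ≥0∞)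
              + rpeAux n (Pz P z) Z * (misclassifiedGood (Pz P z) h Z : ℝ≥0∞)) := by
            refine ENNReal.tsum_le_tsum fun Z => ?_
            by_cases hZ : rpeAux n (Pz P z) Z = 0
            · simp [hZ]
            rw [← mul_add]
            gcongr
            exact_mod_cast misclassifiedGood_cons_le h hlab hz
              (subset_of_mem_support_rpeAux n _ Z ((PMF.mem_support_iff _ _).2 hZ))
        _ ≤ _ := by
            rw [ENNReal.tsum_add, ENNReal.tsum_mul_right, PMF.tsum_coe, one_mul, Nat.cast_add]
            gcongr
            exact ih _ (by have := card_Pz_lt hz; omega) fun x hx => hlab x (hsub x hx)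
    refine (Multiset.sum_map_le_sum_map _ _ step).trans ?_
    have hsum : (P.map fun z => wronglyEliminated P h z + errP (Pz P z) h).sum
        ≤ errP P h * Multiset.card P := by
      calc _ ≤ (P.map fun z => badEliminated P h z + errP (Pz P z) h).sum := by
            rw [Multiset.sum_map_add, Multiset.sum_map_add]
            gcongr ?_ + _
            exact sum_wronglyEliminated_le P h hlab hmono
        _ = _ := by
            simp only [errP_Pz_add_badEliminated, Multiset.map_const', Multiset.sum_replicate,
              smul_eq_mul, mul_comm]
    have hcast := (Nat.cast_le (α := ℝ≥0∞)).2 hsum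
    rw [Nat.cast_multiset_sum, Multiset.map_map, Nat.cast_mul] at hcast
    exact hcast

/-- For any monotone classifier `h`, the expected number of `h`-good elements
of `P` misclassified by `h_RPE` is at most `err_P(h)`. -/
theorem stmt3 {d : ℕ} (P : Multiset ((Fin d → ℝ) × ℤ)) (h : (Fin d → ℝ) → ℤ)
    (hlab : ∀ x ∈ P, x.2 = 1 ∨ x.2 = (-1 : ℤ))
    (hcod : ∀ x : Fin d → ℝ, h x = 1 ∨ h x = -1)
    (hmono : ∀ p q : Fin d → ℝ, dominates p q → h q ≤ h p) :
    ∑' Z : Multiset ((Fin d → ℝ) × ℤ),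
        (rpe P) Z *
          (Multiset.card (P.filter (fun p => h p.1 = p.2 ∧ hRPE Z p.1 ≠ p.2)) : ℝ≥0∞)
      ≤ (errP P h : ℝ≥0∞) := by
  exact tsum_rpeAux_mul_misclassifiedGood_le h hmono _ P le_rfl hlab
end
end

section
/- Let P be a finite multiset of n ≥ 2 labeled points in ℝ (dimension d = 1) and ε ∈ (0,1]. Suppose G₁ is a real-valued function on thresholds such that |G₁(h^τ) − err_P(h^τ)| ≤ εn/64 for every τ ∈ P ∪ {−∞}. Let α be the smallest and β the largest τ ∈ P ∪ {−∞} with G₁(h^τ) < n·(1/4 − ε/64), assuming such τ exist. Then the number of elements p ∈ P with α < p ≤ β is less than n/2. -/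
open scoped Classical

noncomputable section

/-- The one-dimensional threshold classifier `h^τ` (with `τ ∈ ℝ ∪ {−∞}`):
maps `p` to `1` if `p > τ` and to `−1` otherwise. -/
def hThr (τ : WithBot ℝ) : ℝ → ℤ := fun p => if τ < (p : WithBot ℝ) then 1 else -1

/-- The error of a classifier `h` on a labeled multiset `Q` of 1D points. -/
def err1 (Q : Multiset (ℝ × ℤ)) (h : ℝ → ℤ) : ℕ :=
  Multiset.card (Q.filter (fun x => h x.1 ≠ x.2))

/-- `τ` ranges over `P ∪ {−∞}`. -/
def IsThreshold (P : Multiset (ℝ × ℤ)) (τ : WithBot ℝ) : Prop :=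
  τ = ⊥ ∨ ∃ x ∈ P, τ = (x.1 : WithBot ℝ)

theorem card_filter_between_le_err1_add_err1 (P : Multiset (ℝ × ℤ)) (α β : WithBot ℝ) :
    Multiset.card (P.filter
        (fun x => α < (x.1 : WithBot ℝ) ∧ (x.1 : WithBot ℝ) ≤ β))
      ≤ err1 P (hThr α) + err1 P (hThr β) := by
  have hsub : P.filter (fun x => α < (x.1 : WithBot ℝ) ∧ (x.1 : WithBot ℝ) ≤ β)
      ≤ P.filter (fun x => hThr α x.1 ≠ x.2 ∨ hThr β x.1 ≠ x.2) := by
    refine Multiset.monotone_filter_right P fun x ⟨hαx, hxβ⟩ => ?_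
    have h₁ : hThr α x.1 = 1 := if_pos hαx
    have h₂ : hThr β x.1 = -1 := if_neg hxβ.not_gt
    omega
  have hadd := congrArg Multiset.card (Multiset.filter_add_filter
    (fun x : ℝ × ℤ => hThr α x.1 ≠ x.2) (fun x => hThr β x.1 ≠ x.2) P)
  rw [Multiset.card_add, Multiset.card_add] at hadd
  have hle := Multiset.card_le_card hsub
  unfold err1
  omega

/-- If `G₁` approximates `err_P(h^τ)` within `εn/64` for every
`τ ∈ P ∪ {−∞}`, and `α` (resp. `β`) is the smallest (resp. largest)
`τ ∈ P ∪ {−∞}` with `G₁(h^τ) < n(1/4 − ε/64)`, then fewer than `n/2` elements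
`p ∈ P` satisfy `α < p ≤ β`. -/
theorem stmt8 (P : Multiset (ℝ × ℤ)) (n : ℕ) (hn : Multiset.card P = n)
    (hn2 : 2 ≤ n)
    (hlab : ∀ x ∈ P, x.2 = 1 ∨ x.2 = (-1 : ℤ))
    (ε : ℝ) (hε0 : 0 < ε) (hε1 : ε ≤ 1)
    (G₁ : WithBot ℝ → ℝ)
    (hG₁ : ∀ τ : WithBot ℝ, IsThreshold P τ →
      |G₁ τ - (err1 P (hThr τ) : ℝ)| ≤ ε * n / 64)
    (α β : WithBot ℝ)
    (hα : IsLeast {τ : WithBot ℝ |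
      IsThreshold P τ ∧ G₁ τ < (n : ℝ) * (1 / 4 - ε / 64)} α)
    (hβ : IsGreatest {τ : WithBot ℝ |
      IsThreshold P τ ∧ G₁ τ < (n : ℝ) * (1 / 4 - ε / 64)} β) :
    (Multiset.card (P.filter
        (fun x => α < (x.1 : WithBot ℝ) ∧ (x.1 : WithBot ℝ) ≤ β)) : ℝ)
      < (n : ℝ) / 2 := by
  have hcard : (Multiset.card (P.filter
      (fun x => α < (x.1 : WithBot ℝ) ∧ (x.1 : WithBot ℝ) ≤ β)) : ℝ)
      ≤ err1 P (hThr α) + err1 P (hThr β) := by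
    exact_mod_cast card_filter_between_le_err1_add_err1 P α β
  have hα₁ := (abs_le.mp (hG₁ α hα.1.1)).1
  have hβ₁ := (abs_le.mp (hG₁ β hβ.1.1)).1
  have hα₂ := hα.1.2
  have hβ₂ := hβ.1.2
  linarith
end
end

section
/- Let P be a finite multiset of n labeled points in ℝ (dimension d = 1), and let ε, δ ∈ (0,1]. Draw a multiset S of t elements uniformly at random from P with replacement, where t ≥ ⌈3·(64/ε)²·ln(2(n+1)/δ)⌉. Then with probability at least 1 − δ, simultaneously for every τ ∈ P ∪ {−∞}: |(n/t)·err_S(h^τ) − err_P(h^τ)| ≤ εn/64. -/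
open scoped Classical ENNReal
open MeasureTheory

noncomputable section

/-- Upper-tail **Hoeffding inequality** for an i.i.d. sample of bounded observables. -/
theorem hoeffding_pi_upper {α : Type*} [MeasurableSpace α] (μ : Measure α)
    [IsProbabilityMeasure μ] {g : α → ℝ} (hg : Measurable g) {a b : ℝ}
    (hab : ∀ x, g x ∈ Set.Icc a b) (t : ℕ) {s : ℝ} (hs : 0 ≤ s) :
    (Measure.pi (fun _ : Fin t => μ)).real {f | s ≤ ∑ i, (g (f i) - ∫ x, g x ∂μ)} ≤
      Real.exp (-(2 * s ^ 2 / (t * (b - a) ^ 2))) := by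
  have hindep : ProbabilityTheory.iIndepFun
      (fun (i : Fin t) (f : Fin t → α) => g (f i) - ∫ x, g x ∂μ)
      (Measure.pi (fun _ : Fin t => μ)) :=
    ProbabilityTheory.iIndepFun_pi (X := fun _ x => g x - ∫ x, g x ∂μ)
      fun _ => (hg.sub_const _).aemeasurable
  have hsub (i : Fin t) : ProbabilityTheory.HasSubgaussianMGF
      (fun f : Fin t → α => g (f i) - ∫ x, g x ∂μ) ((‖b - a‖₊ / 2) ^ 2)
      (Measure.pi (fun _ : Fin t => μ)) := by
    have hmp := measurePreserving_eval (fun _ : Fin t => μ) i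
    refine ProbabilityTheory.HasSubgaussianMGF.of_map (Y := fun f : Fin t → α => f i)
      (X := fun x => g x - ∫ x, g x ∂μ) hmp.measurable.aemeasurable ?_
    have hmap : Measure.map (fun f : Fin t → α => f i) (Measure.pi fun _ : Fin t => μ) = μ :=
      hmp.map_eq
    rw [hmap]
    exact ProbabilityTheory.hasSubgaussianMGF_of_mem_Icc hg.aemeasurable
      (Filter.Eventually.of_forall hab)
  refine (ProbabilityTheory.HasSubgaussianMGF.measure_sum_ge_le_of_iIndepFun hindep
    (s := Finset.univ) (fun i _ => hsub i) hs).trans_eq ?_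
  congr 1
  have hsq : |b - a| ^ 2 = (b - a) ^ 2 := sq_abs _
  simp only [Finset.sum_const, Finset.card_univ, Fintype.card_fin, nsmul_eq_mul]
  push_cast
  simp only [Real.norm_eq_abs, div_pow, hsq]
  rw [neg_div, ← mul_div_mul_left (s ^ 2) _ (two_ne_zero)]
  congr 2
  ring

/-- Two-sided **Hoeffding inequality** for the empirical frequency of an event in an i.i.d.
sample. -/
theorem hoeffding_pi_indicator {α : Type*} [MeasurableSpace α] (μ : Measure α)
    [IsProbabilityMeasure μ] {A : Set α} (hA : MeasurableSet A) (t : ℕ) {s : ℝ} (hs : 0 ≤ s) :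
    (Measure.pi (fun _ : Fin t => μ)).real
        {f | s ≤ |∑ i, A.indicator (1 : α → ℝ) (f i) - t * μ.real A|} ≤
      2 * Real.exp (-(2 * s ^ 2 / t)) := by
  have hg : Measurable (A.indicator (1 : α → ℝ)) := measurable_one.indicator hA
  have hint : ∫ x, A.indicator (1 : α → ℝ) x ∂μ = μ.real A := integral_indicator_one hA
  have hmem (x : α) : A.indicator (1 : α → ℝ) x ∈ Set.Icc 0 1 := by
    by_cases hx : x ∈ A <;> simp [hx]
  have hup := hoeffding_pi_upper μ hg hmem t hs
  have hlo := hoeffding_pi_upper μ hg.neg (a := -1) (b := 0)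
    (fun x => by simpa [and_comm] using hmem x) t hs
  simp only [Pi.neg_apply, integral_neg, hint, Finset.sum_sub_distrib, Finset.sum_neg_distrib,
    Finset.sum_const, Finset.card_univ, Fintype.card_fin, nsmul_eq_mul] at hup hlo
  norm_num at hup hlo
  refine (measureReal_mono (s₂ := {f | s ≤ ∑ i, A.indicator (1 : α → ℝ) (f i) - t * μ.real A} ∪
    {f | ∑ i, A.indicator (1 : α → ℝ) (f i) + s ≤ t * μ.real A}) ?_).trans
    ((measureReal_union_le _ _).trans ?_)
  · intro f hf
    rcases le_abs.1 (Set.mem_ofPred_eq ▸ hf) with h | h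
    · exact Or.inl h
    · exact Or.inr (show ∑ i, A.indicator (1 : α → ℝ) (f i) + s ≤ t * μ.real A by linarith)
  · linarith

/-- A union bound over a finite set of events of probability at most `η` each. -/
theorem ofReal_one_sub_le_measure_of_forall_compl_le {Ω ι : Type*} [MeasurableSpace Ω]
    (μ : Measure Ω) [IsProbabilityMeasure μ] (T : Finset ι) (bad : ι → Set Ω) {η δ : ℝ}
    (hbad : ∀ i ∈ T, μ.real (bad i) ≤ η) (hη : T.card * η ≤ δ) {G : Set Ω}
    (hG : ∀ ω, (∀ i ∈ T, ω ∉ bad i) → ω ∈ G) : ENNReal.ofReal (1 - δ) ≤ μ G := by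
  have hcover : (Set.univ : Set Ω) ⊆ G ∪ ⋃ i ∈ T, bad i := by
    intro ω _
    by_cases h : ∀ i ∈ T, ω ∉ bad i
    · exact Or.inl (hG ω h)
    · push Not at h
      obtain ⟨i, hi, hω⟩ := h
      exact Or.inr (Set.mem_biUnion hi hω)
  have hunion : μ.real (⋃ i ∈ T, bad i) ≤ δ :=
    (measureReal_biUnion_finset_le T bad).trans
      ((Finset.sum_le_card_nsmul T _ η hbad).trans (by simpa using hη))
  have hone : 1 ≤ μ.real G + μ.real (⋃ i ∈ T, bad i) := by
    simpa using (measureReal_mono (μ := μ) hcover).trans (measureReal_union_le _ _)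
  exact ENNReal.ofReal_le_of_le_toReal (by change 1 - δ ≤ μ.real G; linarith)

theorem PMF.toMeasure_ofMultiset_real {α : Type*} [MeasurableSpace α] (P : Multiset α)
    (hP : P ≠ 0) {A : Set α} (hA : MeasurableSet A) :
    (PMF.ofMultiset P hP).toMeasure.real A = (P.filter (· ∈ A)).card / P.card := by
  have hsum : (∑' x, (((P.filter (· ∈ A)).count x : ℕ) : ℝ≥0∞)) = (P.filter (· ∈ A)).card := by
    rw [tsum_eq_sum (s := (P.filter (· ∈ A)).toFinset)
      (fun x hx => by simpa [Multiset.count_eq_zero] using hx), ← Nat.cast_sum,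
      Multiset.toFinset_sum_count_eq]
  rw [Measure.real, PMF.toMeasure_ofMultiset_apply hP A hA, hsum]
  simp

/-- The labeled points misclassified by `h`. -/
def misclassified (h : ℝ → ℤ) : Set (ℝ × ℤ) := {x | h x.1 ≠ x.2}

theorem measurable_hThr (τ : WithBot ℝ) : Measurable (hThr τ) := by
  refine Measurable.ite ?_ measurable_const measurable_const
  cases τ with
  | bot => simp
  | coe a =>
    simp only [WithBot.coe_lt_coe]
    exact measurableSet_Ioi

theorem measurableSet_misclassified {h : ℝ → ℤ} (hh : Measurable h) :
    MeasurableSet (misclassified h) :=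
  (measurableSet_eq_fun (hh.comp measurable_fst) measurable_snd).compl

theorem err1_ofFn {t : ℕ} (f : Fin t → ℝ × ℤ) (h : ℝ → ℤ) :
    (err1 ((List.ofFn f : List (ℝ × ℤ)) : Multiset (ℝ × ℤ)) h : ℝ) =
      ∑ i, (misclassified h).indicator (1 : ℝ × ℤ → ℝ) (f i) := by
  rw [err1, ← Fin.univ_val_map, Multiset.filter_map, Multiset.card_map]
  simp only [Set.indicator_apply, Pi.one_apply, Finset.sum_boole, Finset.card, Finset.filter]
  congr!

theorem exists_finset_isThreshold (P : Multiset (ℝ × ℤ)) :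
    ∃ T : Finset (WithBot ℝ), T.card ≤ P.card + 1 ∧ ∀ τ, IsThreshold P τ → τ ∈ T := by
  refine ⟨insert ⊥ (P.toFinset.image fun x => (x.1 : WithBot ℝ)), ?_, ?_⟩
  · exact (Finset.card_insert_le _ _).trans
      (Nat.succ_le_succ (Finset.card_image_le.trans (Multiset.toFinset_card_le P)))
  · rintro τ (rfl | ⟨x, hx, rfl⟩)
    · simp
    · exact Finset.mem_insert_of_mem (Finset.mem_image_of_mem _ (Multiset.mem_toFinset.2 hx))

/-- Draw a multiset `S` of `t ≥ ⌈3·(64/ε)²·ln(2(n+1)/δ)⌉` elements uniformly at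
random from `P` with replacement (the product measure over `Fin t` of the
uniform distribution on `P`). Then, with probability at least `1 − δ`,
simultaneously for every `τ ∈ P ∪ {−∞}`:
`|(n/t)·err_S(h^τ) − err_P(h^τ)| ≤ εn/64`. -/
theorem stmt13 (P : Multiset (ℝ × ℤ)) (hP : P ≠ 0) (n : ℕ)
    (hn : Multiset.card P = n)
    (hlab : ∀ x ∈ P, x.2 = 1 ∨ x.2 = (-1 : ℤ))
    (ε δ : ℝ) (hε0 : 0 < ε) (hε1 : ε ≤ 1) (hδ0 : 0 < δ) (hδ1 : δ ≤ 1)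
    (t : ℕ) (ht : ⌈3 * (64 / ε) ^ 2 * Real.log (2 * (n + 1) / δ)⌉₊ ≤ t) :
    ENNReal.ofReal (1 - δ) ≤
      Measure.pi (fun _ : Fin t => (PMF.ofMultiset P hP).toMeasure)
        {f : Fin t → ℝ × ℤ | ∀ τ : WithBot ℝ, IsThreshold P τ →
          |((n : ℝ) / t) * (err1 ((List.ofFn f : List (ℝ × ℤ)) : Multiset (ℝ × ℤ)) (hThr τ) : ℝ)
              - (err1 P (hThr τ) : ℝ)| ≤ ε * n / 64} := by
  set μ := (PMF.ofMultiset P hP).toMeasure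
  obtain ⟨T, hTcard, hT⟩ := exists_finset_isThreshold P
  have hn0 : (0 : ℝ) < n := by
    rw [← hn]; exact_mod_cast Multiset.card_pos.2 hP
  have hratio : 1 < 2 * ((n : ℝ) + 1) / δ := by rw [lt_div_iff₀ hδ0]; linarith
  have hlog : 0 < Real.log (2 * (n + 1) / δ) := Real.log_pos hratio
  have hle : 3 * (64 / ε) ^ 2 * Real.log (2 * (n + 1) / δ) ≤ t := Nat.ceil_le.1 ht
  have ht0 : (0 : ℝ) < t := lt_of_lt_of_le (by positivity) hle
  have hexp : Real.exp (-(2 * (t * (ε / 64)) ^ 2 / t)) ≤ δ / (2 * (n + 1)) := by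
    rw [← inv_div (2 * ((n : ℝ) + 1)) δ, ← Real.exp_log (inv_pos.2 (one_pos.trans hratio)), Real.log_inv]
    refine Real.exp_le_exp.2 (neg_le_neg ?_)
    have h := mul_le_mul_of_nonneg_right hle (sq_nonneg (ε / 64))
    have h1 : 3 * (64 / ε) ^ 2 * Real.log (2 * (n + 1) / δ) * (ε / 64) ^ 2 =
        3 * Real.log (2 * (n + 1) / δ) := by field_simp
    have h2 : 2 * (t * (ε / 64)) ^ 2 / t = 2 * (t * (ε / 64) ^ 2) := by field_simp
    rw [h1] at h
    rw [h2]
    linarith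
  refine ofReal_one_sub_le_measure_of_forall_compl_le _ T
    (fun τ => {f | t * (ε / 64) ≤ |∑ i, (misclassified (hThr τ)).indicator (1 : ℝ × ℤ → ℝ) (f i) -
      t * μ.real (misclassified (hThr τ))|}) (η := δ / (n + 1)) (fun τ _ => ?_) ?_ ?_
  · refine (hoeffding_pi_indicator μ (measurableSet_misclassified (measurable_hThr τ)) t
      (by positivity)).trans ((mul_le_mul_of_nonneg_left hexp zero_le_two).trans_eq ?_)
    field_simp
  · have hc : (T.card : ℝ) ≤ n + 1 := by rw [← hn]; exact_mod_cast hTcard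
    calc T.card * (δ / (n + 1)) ≤ (n + 1) * (δ / (n + 1)) := by gcongr
      _ = δ := by field_simp
  · intro f hf τ hτ
    have hdev := hf τ (hT τ hτ)
    rw [Set.mem_ofPred_eq, not_le] at hdev
    have hmean : μ.real (misclassified (hThr τ)) = err1 P (hThr τ) / n := by
      rw [PMF.toMeasure_ofMultiset_real P hP (measurableSet_misclassified (measurable_hThr τ)), hn, err1]
      congr!
    rw [hmean, ← err1_ofFn] at hdev
    have hscale : (n : ℝ) / t * err1 (List.ofFn f : Multiset (ℝ × ℤ)) (hThr τ) -
        err1 P (hThr τ) = n / t * (err1 (List.ofFn f : Multiset (ℝ × ℤ)) (hThr τ) -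
          t * (err1 P (hThr τ) / n)) := by field_simp
    rw [hscale, abs_mul, abs_of_pos (div_pos hn0 ht0)]
    refine (mul_le_mul_of_nonneg_left hdev.le (div_pos hn0 ht0).le).trans_eq ?_
    field_simp
end
end

section
/- Let n ≥ 4 be an even integer and i ∈ [n/2]. Define two labeled multisets on the points 1, 2, ..., n in ℝ: in P_{−1}(i), every odd point has label 1 and every even point has label −1, except that point 2i−1 has label −1; in P_1(i), every odd point has label 1 and every even point has label −1, except that point 2i has label 1. Then the optimal monotone error of each of P_{−1}(i) and P_1(i) is n/2 − 1, and no monotone classifier h satisfies both err_{P_{−1}(i)}(h) ≤ n/2 − 1 and err_{P_1(i)}(h) ≤ n/2 − 1. -/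
open scoped Classical

noncomputable section

/-- `h` is a one-dimensional monotone classifier: it takes values in `{−1, 1}`
and `h(q) ≤ h(p)` whenever `p > q`. -/
def IsMono1 (h : ℝ → ℤ) : Prop :=
  (∀ p, h p = 1 ∨ h p = -1) ∧ ∀ p q : ℝ, q < p → h q ≤ h p

/-- The default label of a point `x ∈ {1, ..., n}`: `1` if `x` is odd,
`−1` if `x` is even. -/
def oddLabel (x : ℕ) : ℤ := if x % 2 = 1 then 1 else -1

/-- The input `P_{−1}(i)`: points `1, ..., n`, odd points labeled `1` and even
points labeled `−1`, except that `2i − 1` is labeled `−1`. -/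
def Pneg (n i : ℕ) : Multiset (ℝ × ℤ) :=
  (Multiset.range n).map (fun j =>
    (((j + 1 : ℕ) : ℝ), if j + 1 = 2 * i - 1 then -1 else oddLabel (j + 1)))

/-- The input `P_1(i)`: points `1, ..., n`, odd points labeled `1` and even
points labeled `−1`, except that `2i` is labeled `1`. -/
def Ppos (n i : ℕ) : Multiset (ℝ × ℤ) :=
  (Multiset.range n).map (fun j =>
    (((j + 1 : ℕ) : ℝ), if j + 1 = 2 * i then 1 else oddLabel (j + 1)))

/-- The number of errors of `h` on the points `2k + 1` (labeled `1`) and `2k + 2` (labeled `-1`). -/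
def pairErr (h : ℝ → ℤ) (k : ℕ) : ℕ :=
  (if h ((2 * k + 1 : ℕ) : ℝ) ≠ 1 then 1 else 0) + (if h ((2 * k + 2 : ℕ) : ℝ) ≠ -1 then 1 else 0)

theorem err1_map_range_two_mul (l : ℕ → ℤ) (h : ℝ → ℤ) (m : ℕ) :
    err1 ((Multiset.range (2 * m)).map (fun j => (((j + 1 : ℕ) : ℝ), l (j + 1)))) h =
      ∑ k ∈ Finset.range m,
        ((if h ((2 * k + 1 : ℕ) : ℝ) ≠ l (2 * k + 1) then 1 else 0) +
          (if h ((2 * k + 2 : ℕ) : ℝ) ≠ l (2 * k + 2) then 1 else 0)) := by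
  induction m with
  | zero => simp [err1]
  | succ m ih =>
    rw [Finset.sum_range_succ, ← ih, show 2 * (m + 1) = 2 * m + 1 + 1 by ring,
      Multiset.range_succ, Multiset.range_succ]
    simp only [err1, Multiset.map_cons, Multiset.filter_cons, Multiset.card_add]
    split_ifs <;> simp only [Multiset.card_singleton, Multiset.card_zero] <;> ring

theorem err1_Pneg (h : ℝ → ℤ) {m c : ℕ} (hc : c < m) :
    err1 (Pneg (2 * m) (c + 1)) h =
      ((if h ((2 * c + 1 : ℕ) : ℝ) ≠ -1 then 1 else 0) +
        (if h ((2 * c + 2 : ℕ) : ℝ) ≠ -1 then 1 else 0)) +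
      ∑ k ∈ (Finset.range m).erase c, pairErr h k := by
  rw [Pneg, err1_map_range_two_mul (fun j => if j = 2 * (c + 1) - 1 then -1 else oddLabel j),
    ← Finset.add_sum_erase _ _ (Finset.mem_range.2 hc)]
  congr 1
  · simp [oddLabel, show 2 * (c + 1) - 1 = 2 * c + 1 by omega]
  · refine Finset.sum_congr rfl fun k hk => ?_
    have := Finset.ne_of_mem_erase hk
    simp [pairErr, oddLabel, show 2 * k + 1 ≠ 2 * (c + 1) - 1 by omega,
      show 2 * k + 2 ≠ 2 * (c + 1) - 1 by omega, show (2 * k + 1) % 2 = 1 by omega]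

theorem err1_Ppos (h : ℝ → ℤ) {m c : ℕ} (hc : c < m) :
    err1 (Ppos (2 * m) (c + 1)) h =
      ((if h ((2 * c + 1 : ℕ) : ℝ) ≠ 1 then 1 else 0) +
        (if h ((2 * c + 2 : ℕ) : ℝ) ≠ 1 then 1 else 0)) +
      ∑ k ∈ (Finset.range m).erase c, pairErr h k := by
  rw [Ppos, err1_map_range_two_mul (fun j => if j = 2 * (c + 1) then 1 else oddLabel j),
    ← Finset.add_sum_erase _ _ (Finset.mem_range.2 hc)]
  congr 1
  · simp [oddLabel, show 2 * (c + 1) = 2 * c + 2 by ring, show (2 * c + 1) % 2 = 1 by omega]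
  · refine Finset.sum_congr rfl fun k hk => ?_
    have := Finset.ne_of_mem_erase hk
    simp [pairErr, oddLabel, show 2 * k + 1 ≠ 2 * (c + 1) by omega,
      show 2 * k + 2 ≠ 2 * (c + 1) by omega, show (2 * k + 1) % 2 = 1 by omega]

theorem IsMono1.one_le_pairErr {h : ℝ → ℤ} (hh : IsMono1 h) (k : ℕ) : 1 ≤ pairErr h k := by
  have hle := hh.2 ((2 * k + 2 : ℕ) : ℝ) ((2 * k + 1 : ℕ) : ℝ) (by exact_mod_cast Nat.lt_succ_self _)
  unfold pairErr
  split_ifs <;> omega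

theorem IsMono1.le_sum_pairErr {h : ℝ → ℤ} (hh : IsMono1 h) {m c : ℕ} (hc : c < m) :
    m - 1 ≤ ∑ k ∈ (Finset.range m).erase c, pairErr h k := by
  have := Finset.card_nsmul_le_sum ((Finset.range m).erase c) (pairErr h) 1
    fun k _ => hh.one_le_pairErr k
  simpa [Finset.card_erase_of_mem (Finset.mem_range.2 hc)] using this

/-- The classifier with value `-1` exactly on the points at most `t`. -/
def threshold (t : ℕ) (x : ℝ) : ℤ := if x ≤ t then -1 else 1

theorem threshold_natCast (t x : ℕ) : threshold t x = if x ≤ t then -1 else 1 := by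
  simp [threshold]

theorem isMono1_threshold (t : ℕ) : IsMono1 (threshold t) := by
  refine ⟨fun p => ?_, fun p q hpq => ?_⟩
  · unfold threshold
    split_ifs <;> simp
  · unfold threshold
    split_ifs with h₁ h₂
    · rfl
    · norm_num
    · exact absurd (hpq.le.trans ‹_›) h₁
    · rfl

theorem pairErr_threshold_two_mul (s k : ℕ) : pairErr (threshold (2 * s)) k = 1 := by
  simp only [pairErr, threshold_natCast]
  split_ifs <;> omega

theorem sum_pairErr_threshold_two_mul (s : ℕ) {m c : ℕ} (hc : c < m) :
    ∑ k ∈ (Finset.range m).erase c, pairErr (threshold (2 * s)) k = m - 1 := by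
  simp [pairErr_threshold_two_mul, Finset.card_erase_of_mem (Finset.mem_range.2 hc)]

/-- For an even `n ≥ 4` and `i ∈ [n/2]`: the optimal monotone error of each of
`P_{−1}(i)` and `P_1(i)` is `n/2 − 1`, and no monotone classifier achieves
error at most `n/2 − 1` on both inputs simultaneously. -/
theorem stmt14 (n i : ℕ) (hn : 4 ≤ n) (heven : Even n) (hi1 : 1 ≤ i)
    (hi2 : i ≤ n / 2) :
    sInf {m : ℕ | ∃ h : ℝ → ℤ, IsMono1 h ∧ err1 (Pneg n i) h = m} = n / 2 - 1 ∧
    sInf {m : ℕ | ∃ h : ℝ → ℤ, IsMono1 h ∧ err1 (Ppos n i) h = m} = n / 2 - 1 ∧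
    ∀ h : ℝ → ℤ, IsMono1 h →
      ¬(err1 (Pneg n i) h ≤ n / 2 - 1 ∧ err1 (Ppos n i) h ≤ n / 2 - 1) := by
  obtain ⟨m, rfl⟩ := heven.two_dvd
  obtain ⟨c, rfl⟩ := Nat.exists_eq_add_of_le' hi1
  rw [Nat.mul_div_cancel_left m two_pos] at *
  have hc : c < m := hi2
  refine ⟨IsLeast.csInf_eq ⟨⟨threshold (2 * (c + 1)), isMono1_threshold _, ?_⟩, ?_⟩,
    IsLeast.csInf_eq ⟨⟨threshold (2 * c), isMono1_threshold _, ?_⟩, ?_⟩, ?_⟩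
  · rw [err1_Pneg _ hc, sum_pairErr_threshold_two_mul _ hc, threshold_natCast, threshold_natCast,
      if_pos (by omega : 2 * c + 1 ≤ 2 * (c + 1)), if_pos (by omega : 2 * c + 2 ≤ 2 * (c + 1))]
    simp
  · rintro _ ⟨h, hh, rfl⟩
    rw [err1_Pneg _ hc]
    exact le_add_left (hh.le_sum_pairErr hc)
  · rw [err1_Ppos _ hc, sum_pairErr_threshold_two_mul _ hc, threshold_natCast, threshold_natCast,
      if_neg (by omega : ¬2 * c + 1 ≤ 2 * c), if_neg (by omega : ¬2 * c + 2 ≤ 2 * c)]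
    simp
  · rintro _ ⟨h, hh, rfl⟩
    rw [err1_Ppos _ hc]
    exact le_add_left (hh.le_sum_pairErr hc)
  · rintro h hh ⟨hneg, hpos⟩
    rw [err1_Pneg _ hc] at hneg
    rw [err1_Ppos _ hc] at hpos
    have hle := hh.le_sum_pairErr hc
    split_ifs at hneg hpos <;> omega
end
end
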